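/- For every integer n ≥ 2, the combinatorial generalized Hantzsche-Wendt group G_n is a nonunique product group, i.e. G_n does not have the unique product property. -/

import Mathlib

/-- Relators of the combinatorial generalized Hantzsche-Wendt group:
`x_i⁻¹ x_j² x_i x_j²` for all `i ≠ j`. -/
def HWrels (n : ℕ) : Set (FreeGroup (Fin n)) :=
  {r | ∃ i j : Fin n, i ≠ j ∧
    r = (FreeGroup.of i)⁻¹ * (FreeGroup.of j) ^ 2 * FreeGroup.of i * (FreeGroup.of j) ^ 2}

/-- The combinatorial generalized Hantzsche-Wendt group `G_n`. -/
abbrev GHW (n : ℕ) : Type := PresentedGroup (HWrels n)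

/-- The generator `x_i` of `G_n`. -/
def ghw {n : ℕ} (i : Fin n) : GHW n := PresentedGroup.of i

/-- Model of the Promislow group: `(a,b,c,p,q)` stands for `A^a B^b C^c x^p y^q`. -/
@[ext] structure PrM where
  a : ℤ
  b : ℤ
  c : ℤ
  p : Bool
  q : Bool
deriving DecidableEq

def PrM.sg (p : Bool) (a : ℤ) : ℤ := if p then -a else a

instance : Mul PrM := ⟨fun g h =>
  ⟨g.a + PrM.sg g.q h.a + (if g.q && h.p then -1 else 0) + (if g.p && h.p then 1 else 0),
   g.b + PrM.sg g.p h.b + (if g.q && h.p then PrM.sg g.p 1 else 0)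
     + (if g.q && h.q then PrM.sg (xor g.p h.p) 1 else 0),
   g.c + PrM.sg (xor g.p g.q) h.c + (if g.q && h.p then PrM.sg g.p (-1) else 0),
   xor g.p h.p, xor g.q h.q⟩⟩

theorem PrM.mul_def (g h : PrM) : g * h =
  ⟨g.a + PrM.sg g.q h.a + (if g.q && h.p then -1 else 0) + (if g.p && h.p then 1 else 0),
   g.b + PrM.sg g.p h.b + (if g.q && h.p then PrM.sg g.p 1 else 0)
     + (if g.q && h.q then PrM.sg (xor g.p h.p) 1 else 0),
   g.c + PrM.sg (xor g.p g.q) h.c + (if g.q && h.p then PrM.sg g.p (-1) else 0),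
   xor g.p h.p, xor g.q h.q⟩ := rfl

def PrM.U : List PrM :=
  [⟨0,0,0,false,false⟩, ⟨0,0,-1,false,false⟩, ⟨0,1,0,false,false⟩, ⟨0,1,-1,false,false⟩,
   ⟨1,0,0,false,false⟩, ⟨1,0,-1,false,false⟩, ⟨1,1,0,false,false⟩, ⟨1,1,-1,false,false⟩,
   ⟨-1,-1,0,true,false⟩, ⟨1,0,0,true,false⟩, ⟨0,-1,1,true,false⟩, ⟨0,0,1,true,false⟩,
   ⟨0,0,0,false,true⟩, ⟨1,0,0,false,true⟩, ⟨0,-1,1,false,true⟩, ⟨1,1,1,false,true⟩,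
   ⟨0,0,0,true,true⟩, ⟨1,0,-1,true,true⟩, ⟨-1,0,-1,true,true⟩, ⟨0,1,-1,true,true⟩,
   ⟨0,-1,-1,true,true⟩]

/-- Support of the inverse of Gardam's unit. -/
def PrM.inv' (g : PrM) : PrM :=
  match g.p, g.q with
  | false, false => ⟨g.a - 1, -g.b, -g.c, false, false⟩
  | true, false => ⟨g.a - 1, g.b, g.c, true, false⟩
  | false, true => ⟨g.a, g.b - 1, g.c, false, true⟩
  | true, true => ⟨g.a, -g.b, -g.c - 1, true, true⟩

def PrM.V : List PrM := PrM.U.map PrM.inv'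

theorem PrM.nonunique : ∀ u ∈ PrM.U, ∀ v ∈ PrM.V, ∃ u' ∈ PrM.U, ∃ v' ∈ PrM.V,
    u' * v' = u * v ∧ ¬ (u' = u ∧ v' = v) := by
  decide +kernel

theorem PrM.not_uniqueProds : ¬ UniqueProds PrM := by
  intro h
  obtain ⟨u, hu, v, hv, huv⟩ := h.uniqueMul_of_nonempty (A := PrM.U.toFinset)
    (B := PrM.V.toFinset) ⟨⟨0,0,0,false,false⟩, by decide⟩ ⟨⟨-1,0,0,false,false⟩, by decide⟩
  obtain ⟨u', hu', v', hv', he, hne⟩ :=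
    PrM.nonunique u (List.mem_toFinset.1 hu) v (List.mem_toFinset.1 hv)
  exact hne (huv (List.mem_toFinset.2 hu') (List.mem_toFinset.2 hv') he)

section hom
variable {G : Type*} [Group G]

def prT (x y : G) (a b c : ℤ) : G := (x ^ 2) ^ a * (y ^ 2) ^ b * ((x * y) ^ 2) ^ c

def prF (x y : G) (g : PrM) : G :=
  prT x y g.a g.b g.c * (if g.p then x else 1) * (if g.q then y else 1)

theorem prF_mul (x y : G) (h1 : x⁻¹ * y ^ 2 * x * y ^ 2 = 1) (h2 : y⁻¹ * x ^ 2 * y * x ^ 2 = 1)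
    (g h : PrM) : prF x y (g * h) = prF x y g * prF x y h := by
  have xB : SemiconjBy x (y ^ 2) (y ^ 2)⁻¹ := by
    have : SemiconjBy x (y ^ 2)⁻¹ (y ^ 2) := by
      have e := eq_inv_of_mul_eq_one_left h1
      rw [SemiconjBy, ← e]; group
    simpa using this.inv_right
  have yA : SemiconjBy y (x ^ 2) (x ^ 2)⁻¹ := by
    have : SemiconjBy y (x ^ 2)⁻¹ (x ^ 2) := by
      have e := eq_inv_of_mul_eq_one_left h2
      rw [SemiconjBy, ← e]; group
    simpa using this.inv_right
  have xA : SemiconjBy x (x ^ 2) (x ^ 2) := (Commute.refl x).pow_right 2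
  have yB : SemiconjBy y (y ^ 2) (y ^ 2) := (Commute.refl y).pow_right 2
  have AB : Commute (x ^ 2) (y ^ 2) := by
    have := xB.inv_right.mul_left xB
    rw [inv_inv, ← pow_two] at this; exact this
  have zA : SemiconjBy (x * y) (x ^ 2) (x ^ 2)⁻¹ := xA.inv_right.mul_left yA
  have zB : SemiconjBy (x * y) (y ^ 2) (y ^ 2)⁻¹ := xB.mul_left yB
  have CA : Commute ((x * y) ^ 2) (x ^ 2) := by
    have := zA.inv_right.mul_left zA
    rw [inv_inv, ← pow_two] at this; exact this
  have CB : Commute ((x * y) ^ 2) (y ^ 2) := by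
    have := zB.inv_right.mul_left zB
    rw [inv_inv, ← pow_two] at this; exact this
  have xC : SemiconjBy x ((x * y) ^ 2) ((x * y) ^ 2)⁻¹ := by
    rw [SemiconjBy, eq_inv_mul_iff_mul_eq]
    have e1 : (x * y) ^ 2 * (x * (x * y) ^ 2) = x * (y * x) * (y * x ^ 2) * (y * x * y) := by
      simp only [pow_two, mul_assoc]
    have e2 := yA.eq
    have e3 : x * (y * x) * (y * x ^ 2) * (y * x * y) = x * y * x * (x^2)⁻¹ * y ^ 2 * x * y := by
      rw [e2]; simp only [pow_two, mul_assoc]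
    have e4 : x * y * x * (x^2)⁻¹ * y ^ 2 * x * y = x * y * x⁻¹ * (y ^ 2 * x) * y := by
      group
    have e5 : y ^ 2 * x = x * (y ^ 2)⁻¹ := by
      have := xB.inv_right.eq
      rw [inv_inv] at this; exact this.symm
    rw [e1, e3, e4, e5]; group
  have zC : SemiconjBy (x * y) ((x * y) ^ 2) ((x * y) ^ 2) := (Commute.refl _).pow_right 2
  have yC : SemiconjBy y ((x * y) ^ 2) ((x * y) ^ 2)⁻¹ := by
    have h0 := xC.inv_right
    rw [inv_inv] at h0
    have h := h0.inv_symm_left.mul_left zC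
    simpa using h
  have TT : ∀ a b c a' b' c', prT x y a b c * prT x y a' b' c'
      = prT x y (a + a') (b + b') (c + c') := by
    intro a b c a' b' c'
    simp only [prT, zpow_add]
    have k1 := ((CA.zpow_zpow c a').eq)
    have k2 := ((CB.zpow_zpow c b').eq)
    have k3 := ((AB.zpow_zpow a' b).eq)
    generalize (x ^ 2) ^ a = A at *
    generalize (x ^ 2) ^ a' = A' at *
    generalize (y ^ 2) ^ b = B at *
    generalize (y ^ 2) ^ b' = B' at *
    generalize ((x * y) ^ 2) ^ c = C at *
    generalize ((x * y) ^ 2) ^ c' = C' at *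
    calc A * B * C * (A' * B' * C') = A * B * (C * A') * B' * C' := by simp only [mul_assoc]
      _ = A * B * A' * (C * B') * C' := by rw [k1]; simp only [mul_assoc]
      _ = A * (B * A') * B' * C * C' := by rw [k2]; simp only [mul_assoc]
      _ = _ := by rw [← k3]; simp only [mul_assoc]
  have xT : ∀ a b c, x * prT x y a b c = prT x y a (-b) (-c) * x := by
    intro a b c
    have := ((xA.zpow_right a).mul_right (xB.zpow_right b)).mul_right (xC.zpow_right c)
    simpa only [SemiconjBy, prT, zpow_neg, inv_zpow] using this
  have yT : ∀ a b c, y * prT x y a b c = prT x y (-a) b (-c) * y := by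
    intro a b c
    have := ((yA.zpow_right a).mul_right (yB.zpow_right b)).mul_right (yC.zpow_right c)
    simpa only [SemiconjBy, prT, zpow_neg, inv_zpow] using this
  have xx : x * x = prT x y 1 0 0 := by simp [prT, pow_two]
  have yy : y * y = prT x y 0 1 0 := by simp [prT, pow_two]
  have T0 : prT x y 0 0 0 = 1 := by simp [prT]
  have yx : y * x = prT x y (-1) 1 (-1) * (x * y) := by
    have e0 : x * (y * (x * y)) = prT x y 0 0 1 := by simp [prT, pow_two, mul_assoc]
    have t : x * x * (y * x * y) = prT x y 0 0 (-1) * x := by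
      have : x * (x * (y * (x * y))) = prT x y 0 0 (-1) * x := by
        rw [e0, xT]; simp
      simpa only [mul_assoc] using this
    have t2 : y * x * y = prT x y (-1) 0 (-1) * x := by
      rw [xx] at t
      have := congrArg (prT x y (-1) 0 0 * ·) t
      simp only [← mul_assoc, TT] at this
      simpa [T0, mul_assoc] using this
    apply mul_right_cancel (b := y)
    rw [t2, mul_assoc, mul_assoc x, yy, xT, ← mul_assoc, TT]
    simp
  have r1 := fun (g : G) => (mul_assoc x x g).symm.trans (congrArg (· * g) xx)
  have r3 := fun (g : G) => (mul_assoc y x g).symm.trans (congrArg (· * g) yx)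
  have r4 := fun a b c (g : G) => (mul_assoc x _ g).symm.trans (congrArg (· * g) (xT a b c))
  have r5 := fun a b c (g : G) => (mul_assoc y _ g).symm.trans (congrArg (· * g) (yT a b c))
  have r6 := fun a b c a' b' c' (g : G) =>
    (mul_assoc _ _ g).symm.trans (congrArg (· * g) (TT a b c a' b' c'))
  obtain ⟨a, b, c, p, q⟩ := g
  obtain ⟨a', b', c', p', q'⟩ := h
  cases p <;> cases q <;> cases p' <;> cases q' <;>
  simp [prF, PrM.mul_def, PrM.sg, mul_assoc, xx, yy, yx, xT, yT, TT, r1, r3, r4, r5, r6] <;>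
  (congr 1 <;> ring)
end hom

abbrev Z3 : Type := ℤ × ℤ × ℤ

def prX : Equiv.Perm Z3 where
  toFun v := (v.1 + 1, -v.2.1, -v.2.2)
  invFun v := (v.1 - 1, -v.2.1, -v.2.2)
  left_inv v := by simp
  right_inv v := by simp

def prY : Equiv.Perm Z3 where
  toFun v := (-v.1, v.2.1 + 1, 1 - v.2.2)
  invFun v := (-v.1, v.2.1 - 1, 1 - v.2.2)
  left_inv v := by simp
  right_inv v := by simp

def prN : Equiv.Perm Z3 := Equiv.neg Z3

def prGen {n : ℕ} (i : Fin n) : Equiv.Perm Z3 :=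
  if i.val = 0 then prX else if i.val = 1 then prY else prN

theorem prX_sq : prX ^ 2 = Equiv.addRight ((2, 0, 0) : Z3) := by
  ext v <;> simp [prX, pow_two]; ring

theorem prY_sq : prY ^ 2 = Equiv.addRight ((0, 2, 0) : Z3) := by
  ext v <;> simp [prY, pow_two]; ring

theorem prXY_sq : (prX * prY) ^ 2 = Equiv.addRight ((0, 0, -2) : Z3) := by
  ext v <;> simp [prX, prY, pow_two]; ring

theorem prN_sq : prN ^ 2 = 1 := by
  ext v <;> simp [prN, pow_two]

theorem prGen_rel {n : ℕ} (i j : Fin n) (hij : i ≠ j) :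
    (prGen i)⁻¹ * prGen j ^ 2 * prGen i * prGen j ^ 2 = 1 := by
  have hij' : i.val ≠ j.val := fun h => hij (Fin.ext h)
  have key : prGen j ^ 2 * (prGen i * prGen j ^ 2) = prGen i := by
    unfold prGen
    split_ifs <;> first | omega | (simp only [prX_sq, prY_sq, prN_sq, one_mul, mul_one]) <;>
      (ext v <;> simp [prX, prY, prN])
  rw [mul_assoc, mul_assoc, key, inv_mul_cancel]

def prRho (n : ℕ) : GHW n →* Equiv.Perm Z3 :=
  PresentedGroup.toGroup (f := prGen) (by
    rintro r ⟨i, j, hij, rfl⟩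
    simpa using prGen_rel i j hij)

theorem prRho_of {n : ℕ} (i : Fin n) : prRho n (ghw i) = prGen i :=
  PresentedGroup.toGroup.of _

theorem ghw_rel {n : ℕ} (i j : Fin n) (hij : i ≠ j) :
    (ghw i)⁻¹ * ghw j ^ 2 * ghw i * ghw j ^ 2 = 1 := by
  have := PresentedGroup.one_of_mem (rels := HWrels n) ⟨i, j, hij, rfl⟩
  simp only [map_mul, map_inv, map_pow] at this
  exact this

theorem pr_zpow (t : Z3) (a : ℤ) : (Equiv.addRight t) ^ a = Equiv.addRight (a • t) := by
  have hadd : ∀ s t : Z3, Equiv.addRight s * Equiv.addRight t = Equiv.addRight (t + s) := by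
    intro s t
    apply Equiv.ext
    intro v
    simp [add_assoc]
  let φ : Multiplicative Z3 →* Equiv.Perm Z3 :=
    MonoidHom.mk' (fun s => Equiv.addRight s.toAdd) (by
      intro s t
      rw [hadd, toAdd_mul, add_comm])
  exact (map_zpow φ (Multiplicative.ofAdd t) a).symm

theorem prF_inj : Function.Injective (prF prX prY) := by
  intro g h hgh
  have := congrArg (fun e : Equiv.Perm Z3 => e (0, 0, 0)) hgh
  obtain ⟨a, b, c, p, q⟩ := g
  obtain ⟨a', b', c', p', q'⟩ := h
  simp only [prF, prT, prX_sq, prY_sq, prXY_sq, pr_zpow] at this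
  cases p <;> cases q <;> cases p' <;> cases q' <;>
    simp [prX, prY] at this ⊢ <;> omega

theorem ghw_not_uniqueProds (n : ℕ) (hn : 2 ≤ n) : ¬ UniqueProds (GHW n) := by
  intro hU
  let i : Fin n := ⟨0, by omega⟩
  let j : Fin n := ⟨1, by omega⟩
  have hij : i ≠ j := by simp [i, j]
  let f : PrM →ₙ* GHW n :=
    ⟨prF (ghw i) (ghw j), prF_mul _ _ (ghw_rel i j hij) (ghw_rel j i hij.symm)⟩
  have hf : ∀ g, prRho n (f g) = prF prX prY g := by
    intro g
    have hi : prRho n (ghw i) = prX := by rw [prRho_of]; simp [prGen, i]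
    have hj : prRho n (ghw j) = prY := by rw [prRho_of]; simp [prGen, j]
    change prRho n (prF (ghw i) (ghw j) g) = _
    unfold prF prT
    split_ifs <;> simp [hi, hj]
  refine PrM.not_uniqueProds (UniqueProds.of_injective_mulHom f (fun g h hgh => ?_) hU)
  apply prF_inj
  rw [← hf, ← hf, hgh]
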